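/- There exists a constant C > 0 such that for all real-valued Schwartz functions y, W, P on ℝ with z = 4y - y'' and P - P'' = (3/2)(2zW + W²) on ℝ, one has |∫_ℝ (z W' + W z' + W W' + P')(y - y'') dx| ≤ C(1 + ‖W'‖_{L^∞}) S(y) + C ‖W'‖_{L^∞}² ‖W‖_{L²}², where S(y) = 4‖y‖_{L²}² + 5‖y'‖_{L²}² + ‖y''‖_{L²}². -/

import Mathlib

open MeasureTheory Filter Topology SchwartzMap

lemma aux_mul (f g : SchwartzMap ℝ ℝ) : ∃ h : SchwartzMap ℝ ℝ, ∀ x, h x = f x * g x :=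
  ⟨SchwartzMap.pairing (ContinuousLinearMap.mul ℝ ℝ) f g, fun x => by simp⟩

lemma aux_deriv (f : SchwartzMap ℝ ℝ) : ∃ h : SchwartzMap ℝ ℝ, deriv ⇑f = ⇑h ∧
    ∀ x, HasDerivAt ⇑f (h x) x :=
  ⟨SchwartzMap.derivCLM ℝ ℝ f, by ext x; simp, fun x => by
    have := (f.differentiableAt (x := x)).hasDerivAt
    simpa using this⟩

lemma aux_bdd (f : SchwartzMap ℝ ℝ) : BddAbove (Set.range fun x => |f x|) := by
  obtain ⟨C, hC⟩ := f.decay 0 0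
  refine ⟨C, ?_⟩
  rintro _ ⟨x, rfl⟩
  simpa using hC.2 x

/-- There is a constant `C > 0` such that for all real Schwartz functions
`y`, `W`, `P` with `z = 4y - y''` and `P - P'' = (3/2)(2zW + W²)`,
`|∫ (z W' + W z' + W W' + P')(y - y'')| ≤ C(1 + ‖W'‖_∞) S(y) + C ‖W'‖_∞² ‖W‖_{L²}²`. -/
theorem stmt_12 :
    ∃ C : ℝ, 0 < C ∧ ∀ y W P : SchwartzMap ℝ ℝ,
      (∀ x, P x - deriv (deriv ⇑P) x
          = (3/2) * (2 * (4 * y x - deriv (deriv ⇑y) x) * W x + (W x) ^ 2)) →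
      |∫ x, ((4 * y x - deriv (deriv ⇑y) x) * deriv ⇑W x
            + W x * deriv (fun t => 4 * y t - deriv (deriv ⇑y) t) x
            + W x * deriv ⇑W x + deriv ⇑P x) * (y x - deriv (deriv ⇑y) x)|
        ≤ C * (1 + ⨆ x : ℝ, |deriv ⇑W x|) *
            (4 * (∫ x, (y x) ^ 2) + 5 * (∫ x, (deriv ⇑y x) ^ 2)
              + ∫ x, (deriv (deriv ⇑y) x) ^ 2)
          + C * (⨆ x : ℝ, |deriv ⇑W x|) ^ 2 * ∫ x, (W x) ^ 2 := by
  refine ⟨20, by norm_num, fun y W P hP => ?_⟩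
  obtain ⟨y1, e1, d0⟩ := aux_deriv y
  obtain ⟨y2, e2, d1⟩ := aux_deriv y1
  obtain ⟨y3, e3, d2⟩ := aux_deriv y2
  obtain ⟨W1, eW, dW⟩ := aux_deriv W
  obtain ⟨P1, eP, dP⟩ := aux_deriv P
  obtain ⟨P2, eP2, dP1⟩ := aux_deriv P1
  have ez : ∀ x, deriv (fun t => 4 * y t - y2 t) x = 4 * y1 x - y3 x := fun x =>
    (((d0 x).const_mul 4).sub (d2 x)).deriv
  simp only [e1, e2, eW, eP, eP2, ez] at hP ⊢
  set M := ⨆ x : ℝ, |W1 x| with hM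
  have hWM : ∀ x, |W1 x| ≤ M := fun x => le_ciSup (aux_bdd W1) x
  have hM0 : 0 ≤ M := (abs_nonneg _).trans (hWM 0)
  -- Schwartz products
  obtain ⟨a1, ha1⟩ := aux_mul P y
  obtain ⟨a2, ha2⟩ := aux_mul P1 y1
  obtain ⟨yy, hyy⟩ := aux_mul y y
  obtain ⟨y11, hy11⟩ := aux_mul y1 y1
  obtain ⟨y22, hy22⟩ := aux_mul y2 y2
  obtain ⟨y02, hy02⟩ := aux_mul y y2
  obtain ⟨WW, hWW⟩ := aux_mul W W
  obtain ⟨a3, ha3⟩ := aux_mul W yy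
  obtain ⟨a4, ha4⟩ := aux_mul W y22
  obtain ⟨a5, ha5⟩ := aux_mul W y02
  obtain ⟨a6, ha6⟩ := aux_mul WW y
  obtain ⟨G, hG⟩ : ∃ G : SchwartzMap ℝ ℝ, ∀ x, G x = P x * y x - P1 x * y1 x
      - 4 * (W x * (y x * y x)) + 1/2 * (W x * (y2 x * y2 x)) - W x * (y x * y2 x)
      - 3/2 * ((W x * W x) * y x) :=
    ⟨a1 - a2 - (4:ℝ) • a3 + (1/2:ℝ) • a4 - a5 - (3/2:ℝ) • a6, fun x => by
      simp [ha1, ha2, ha3, ha4, ha5, ha6, hyy, hy22, hy02, hWW]⟩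
  obtain ⟨G1, -, dG⟩ := aux_deriv G
  have hG1 : ∀ x, G1 x = P1 x * y x + P x * y1 x - (P2 x * y1 x + P1 x * y2 x)
      - 4 * (W1 x * (y x * y x) + W x * (y1 x * y x + y x * y1 x))
      + 1/2 * (W1 x * (y2 x * y2 x) + W x * (y3 x * y2 x + y2 x * y3 x))
      - (W1 x * (y x * y2 x) + W x * (y1 x * y2 x + y x * y3 x))
      - 3/2 * ((W1 x * W x + W x * W1 x) * y x + (W x * W x) * y1 x) := fun x => by
    have h1 := dG x
    rw [show ⇑G = _ from funext hG] at h1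
    refine h1.unique ?_
    exact (((((((dP x).mul (d0 x)).sub ((dP1 x).mul (d1 x))).sub
      (((dW x).mul ((d0 x).mul (d0 x))).const_mul 4)).add
      (((dW x).mul ((d2 x).mul (d2 x))).const_mul (1/2))).sub
      ((dW x).mul ((d0 x).mul (d2 x)))).sub
      ((((dW x).mul (dW x)).mul (d0 x)).const_mul (3/2)))
  have hGint : ∫ x, G1 x = 0 :=
    integral_eq_zero_of_hasDerivAt_of_integrable dG G1.integrable G.integrable
  obtain ⟨b1, hb1⟩ := aux_mul W1 yy
  obtain ⟨b2, hb2⟩ := aux_mul W1 y02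
  obtain ⟨b3, hb3⟩ := aux_mul W1 y22
  obtain ⟨b4, hb4⟩ := aux_mul W W1
  obtain ⟨b5, hb5⟩ := aux_mul b4 y
  obtain ⟨b6, hb6⟩ := aux_mul b4 y2
  obtain ⟨H, hH⟩ : ∃ H : SchwartzMap ℝ ℝ, ∀ x, H x =
      W1 x * (8 * y x ^ 2 - 4 * (y x * y2 x) + 1/2 * y2 x ^ 2)
      + W x * W1 x * (4 * y x - y2 x) :=
    ⟨(8:ℝ) • b1 - (4:ℝ) • b2 + (1/2:ℝ) • b3 + (4:ℝ) • b5 - b6, fun x => by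
      simp [hb1, hb2, hb3, hb4, hb5, hb6, hyy, hy02, hy22]; ring⟩
  have key : ∀ x, ((4 * y x - y2 x) * W1 x + W x * (4 * y1 x - y3 x)
      + W x * W1 x + P1 x) * (y x - y2 x) = G1 x + H x := fun x => by
    rw [hG1, hH]
    linear_combination (-y1 x) * hP x
  simp only [key]
  rw [integral_add G1.integrable H.integrable, hGint, zero_add]
  have iy : Integrable fun x => y x ^ 2 := by
    simpa [hyy, pow_two] using (yy.integrable (μ := volume)).congr (.of_forall hyy)
  have iy1 : Integrable fun x => y1 x ^ 2 := by
    simpa [pow_two] using (y11.integrable (μ := volume)).congr (.of_forall hy11)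
  have iy2 : Integrable fun x => y2 x ^ 2 := by
    simpa [pow_two] using (y22.integrable (μ := volume)).congr (.of_forall hy22)
  have iW : Integrable fun x => W x ^ 2 := by
    simpa [pow_two] using (WW.integrable (μ := volume)).congr (.of_forall hWW)
  have i1 : Integrable fun x => 4 * y x ^ 2 + 5 * y1 x ^ 2 :=
    (iy.const_mul 4).add (iy1.const_mul 5)
  have i2 : Integrable fun x => 4 * y x ^ 2 + 5 * y1 x ^ 2 + y2 x ^ 2 := i1.add iy2
  have hR : 20 * (1 + M) * (4 * (∫ x, y x ^ 2) + 5 * (∫ x, y1 x ^ 2) + ∫ x, y2 x ^ 2)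
      + 20 * M ^ 2 * ∫ x, W x ^ 2
      = ∫ x, (20 * (1 + M) * (4 * y x ^ 2 + 5 * y1 x ^ 2 + y2 x ^ 2) + 20 * M ^ 2 * W x ^ 2) := by
    rw [integral_add (i2.const_mul _) (iW.const_mul _), integral_const_mul, integral_const_mul,
      integral_add i1 iy2, integral_add (iy.const_mul 4) (iy1.const_mul 5),
      integral_const_mul, integral_const_mul]
  rw [hR]
  refine abs_integral_le_integral_abs.trans ?_
  refine integral_mono H.integrable.abs ((i2.const_mul _).add (iW.const_mul _)) fun x => ?_
  show |H x| ≤ 20 * (1 + M) * (4 * y x ^ 2 + 5 * y1 x ^ 2 + y2 x ^ 2) + 20 * M ^ 2 * W x ^ 2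
  rw [hH]
  refine (abs_add_le _ _).trans ?_
  have t1 : |W1 x * (8 * y x ^ 2 - 4 * (y x * y2 x) + 1/2 * y2 x ^ 2)|
      ≤ M * (10 * y x ^ 2 + 5/2 * y2 x ^ 2) := by
    rw [abs_mul]
    refine mul_le_mul (hWM x) ?_ (abs_nonneg _) hM0
    rw [abs_le]
    constructor <;> nlinarith [sq_nonneg (y x - y2 x), sq_nonneg (y x + y2 x), sq_nonneg (y x)]
  have t2 : |W x * W1 x * (4 * y x - y2 x)|
      ≤ 1/2 * (M ^ 2 * W x ^ 2) + 1/2 * (4 * y x - y2 x) ^ 2 := by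
    have hsq : W1 x ^ 2 ≤ M ^ 2 := sq_le_sq' (neg_le_of_abs_le (hWM x)) (le_of_abs_le (hWM x))
    have := mul_le_mul_of_nonneg_right hsq (sq_nonneg (W x))
    rw [abs_le]
    constructor <;> nlinarith [sq_nonneg (W x * W1 x - (4 * y x - y2 x)),
      sq_nonneg (W x * W1 x + (4 * y x - y2 x))]
  have t3 : (4 * y x - y2 x) ^ 2 ≤ 32 * y x ^ 2 + 2 * y2 x ^ 2 := by
    nlinarith [sq_nonneg (4 * y x + y2 x)]
  have p1 := mul_nonneg hM0 (sq_nonneg (y x))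
  have p2 := mul_nonneg hM0 (sq_nonneg (y1 x))
  have p3 := mul_nonneg hM0 (sq_nonneg (y2 x))
  have p4 := mul_nonneg (sq_nonneg M) (sq_nonneg (W x))
  nlinarith [sq_nonneg (y x), sq_nonneg (y1 x), sq_nonneg (y2 x)]
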